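/- The center map Ψ : Π → ℝ³ is linear, and: if exactly one of the equalities m_A = m_C, m_B = m_D holds, then the image of Ψ is a 2-dimensional linear subspace of ℝ³ (a plane through the origin); if both m_A = m_C and m_B = m_D hold, then the image of Ψ is a 1-dimensional linear subspace of ℝ³ (a line through the origin). -/

import Mathlib

noncomputable section

open Real Set

/-- Membership predicate for conformally inscribed parallelograms.
Coordinates of `P : Fin 9 → ℝ`:
`0 = x_A, 1 = y_A, 2 = x_B, 3 = y_B, 4 = x_C, 5 = y_C, 6 = x_D, 7 = y_D, 8 = w`.
The vertex `(x_L, y_L)` lies on the line `L(w)` for `L ∈ {A,B,C,D}` and the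
midpoints of the two diagonals coincide. -/
def IsCIP (mA mB mC mD bA : ℝ) (P : Fin 9 → ℝ) : Prop :=
  P 1 = mA * P 0 + bA * P 8 ∧
  P 3 = mB * P 2 + P 8 ∧
  P 5 = mC * P 4 ∧
  P 7 = mD * P 6 ∧
  P 0 + P 4 = P 2 + P 6 ∧
  P 1 + P 5 = P 3 + P 7

/-- `Π`, the set of conformally inscribed parallelograms. -/
def CIP (mA mB mC mD bA : ℝ) : Set (Fin 9 → ℝ) := {P | IsCIP mA mB mC mD bA P}

/-- The `AC` diagonal vector of a parallelogram. -/
def vAC (P : Fin 9 → ℝ) : ℝ × ℝ := (P 0 - P 4, P 1 - P 5)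

/-- The `BD` diagonal vector of a parallelogram. -/
def vBD (P : Fin 9 → ℝ) : ℝ × ℝ := (P 2 - P 6, P 3 - P 7)

/-- The `AB` side vector of a parallelogram. -/
def vAB (P : Fin 9 → ℝ) : ℝ × ℝ := (P 0 - P 2, P 1 - P 3)

/-- The `BC` side vector of a parallelogram. -/
def vBC (P : Fin 9 → ℝ) : ℝ × ℝ := (P 2 - P 4, P 3 - P 5)

/-- Dot product in `ℝ²`. -/
def dot2 (a b : ℝ × ℝ) : ℝ := a.1 * b.1 + a.2 * b.2

/-- The inner product `⟨P, Q⟩ = P_AC · Q_AC + P_BD · Q_BD` on `Π`. -/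
def pinner (P Q : Fin 9 → ℝ) : ℝ := dot2 (vAC P) (vAC Q) + dot2 (vBD P) (vBD Q)

/-- The center map `Ψ : Π → ℝ³`, sending `P` to its center together with its scale. -/
def centerMap (P : Fin 9 → ℝ) : ℝ × ℝ × ℝ := ((P 0 + P 4) / 2, (P 1 + P 5) / 2, P 8)

/-- A point is the center of a conformally inscribed parallelogram iff it is the midpoint of a
segment from `A(w)` to `C(w)` and of a segment from `B(w)` to `D(w)`. -/
theorem mem_image_centerMap_iff (mA mB mC mD bA x y w : ℝ) :
    (x, y, w) ∈ centerMap '' CIP mA mB mC mD bA ↔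
      (∃ a c, a + c = 2 * x ∧ mA * a + bA * w + mC * c = 2 * y) ∧
      (∃ b d, b + d = 2 * x ∧ mB * b + w + mD * d = 2 * y) := by
  constructor
  · rintro ⟨P, ⟨hA, hB, hC, hD, hx, hy⟩, hP⟩
    simp only [centerMap, Prod.mk.injEq] at hP
    obtain ⟨rfl, rfl, rfl⟩ := hP
    exact ⟨⟨P 0, P 4, by ring, by linarith⟩, ⟨P 2, P 6, by linarith, by linarith⟩⟩
  · rintro ⟨⟨a, c, hac, hac'⟩, ⟨b, d, hbd, hbd'⟩⟩
    refine ⟨![a, mA * a + bA * w, b, mB * b + w, c, mC * c, d, mD * d, w],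
      ⟨rfl, rfl, rfl, rfl, hac.trans hbd.symm, hac'.trans hbd'.symm⟩, ?_⟩
    refine Prod.ext ?_ (Prod.ext ?_ rfl)
    · change (a + c) / 2 = x
      linarith
    · change (mA * a + bA * w + mC * c) / 2 = y
      linarith

/-- Every point is the midpoint of a segment joining two given nonparallel lines. -/
theorem exists_midpoint_of_slope_ne {m n : ℝ} (h : m ≠ n) (t x y : ℝ) :
    ∃ a c, a + c = 2 * x ∧ m * a + t + n * c = 2 * y := by
  have h' : m - n ≠ 0 := sub_ne_zero.mpr h
  refine ⟨(2 * y - t - 2 * n * x) / (m - n), 2 * x - (2 * y - t - 2 * n * x) / (m - n),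
    by ring, ?_⟩
  field_simp
  ring

/-- The midpoints of segments joining two parallel lines form the line halfway between them. -/
theorem exists_midpoint_of_slope_eq_iff (m t x y : ℝ) :
    (∃ a c, a + c = 2 * x ∧ m * a + t + m * c = 2 * y) ↔ y = m * x + t / 2 := by
  constructor
  · rintro ⟨a, c, h, h'⟩
    linear_combination (m * h - h') / 2
  · rintro rfl
    exact ⟨x, x, by ring, by ring⟩

/-- The plane `y = m x + b w` is a two-dimensional subspace of `ℝ³`. -/
theorem exists_submodule_plane (m b : ℝ) :
    ∃ S : Submodule ℝ (ℝ × ℝ × ℝ),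
      (∀ x y w, (x, y, w) ∈ S ↔ y = m * x + b * w) ∧ Module.finrank ℝ S = 2 := by
  let f : ℝ × ℝ →ₗ[ℝ] ℝ × ℝ × ℝ :=
    (LinearMap.fst ℝ ℝ ℝ).prod
      ((m • LinearMap.fst ℝ ℝ ℝ + b • LinearMap.snd ℝ ℝ ℝ).prod (LinearMap.snd ℝ ℝ ℝ))
  have hf : ∀ p, f p = (p.1, m * p.1 + b * p.2, p.2) := fun _ => rfl
  refine ⟨LinearMap.range f, fun x y w => ?_, ?_⟩
  · constructor
    · rintro ⟨p, hp⟩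
      simp only [hf, Prod.mk.injEq] at hp
      obtain ⟨rfl, rfl, rfl⟩ := hp
      rfl
    · rintro rfl
      exact ⟨(x, w), rfl⟩
  · rw [LinearMap.finrank_range_of_inj]
    · simp
    · intro p q h
      simp only [hf, Prod.mk.injEq] at h
      exact Prod.ext h.1 h.2.2

theorem stmt_16 (mA mB mC mD bA : ℝ) (hCD : mC ≠ mD) :
    (∀ (c : ℝ) (P Q : Fin 9 → ℝ),
        centerMap (c • P + Q) = c • centerMap P + centerMap Q) ∧
    (((mA = mC ∧ mB ≠ mD) ∨ (mA ≠ mC ∧ mB = mD)) →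
      ∃ S : Submodule ℝ (ℝ × ℝ × ℝ),
        (S : Set (ℝ × ℝ × ℝ)) = centerMap '' CIP mA mB mC mD bA ∧
        Module.finrank ℝ S = 2) ∧
    ((mA = mC ∧ mB = mD) →
      ∃ S : Submodule ℝ (ℝ × ℝ × ℝ),
        (S : Set (ℝ × ℝ × ℝ)) = centerMap '' CIP mA mB mC mD bA ∧
        Module.finrank ℝ S = 1) := by
  refine ⟨fun c P Q => ?_, ?_, ?_⟩
  · ext <;> simp [centerMap] <;> ring
  · rintro (⟨rfl, hBD⟩ | ⟨hAC, rfl⟩)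
    · obtain ⟨S, hS, hrank⟩ := exists_submodule_plane mA (bA / 2)
      refine ⟨S, ?_, hrank⟩
      ext ⟨x, y, w⟩
      rw [SetLike.mem_coe, hS, mem_image_centerMap_iff, exists_midpoint_of_slope_eq_iff,
        and_iff_left (exists_midpoint_of_slope_ne hBD w x y), mul_div_right_comm]
    · obtain ⟨S, hS, hrank⟩ := exists_submodule_plane mB (1 / 2)
      refine ⟨S, ?_, hrank⟩
      ext ⟨x, y, w⟩
      rw [SetLike.mem_coe, hS, mem_image_centerMap_iff, exists_midpoint_of_slope_eq_iff,
        and_iff_right (exists_midpoint_of_slope_ne hAC (bA * w) x y), one_div_mul_eq_div]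
  · rintro ⟨rfl, rfl⟩
    have h : mA - mB ≠ 0 := sub_ne_zero.mpr hCD
    refine ⟨Submodule.span ℝ {((1 - bA) / (2 * (mA - mB)),
      mB * ((1 - bA) / (2 * (mA - mB))) + 1 / 2, 1)}, ?_, finrank_span_singleton (by simp)⟩
    ext ⟨x, y, w⟩
    rw [SetLike.mem_coe, Submodule.mem_span_singleton, mem_image_centerMap_iff,
      exists_midpoint_of_slope_eq_iff, exists_midpoint_of_slope_eq_iff]
    simp only [Prod.smul_mk, smul_eq_mul, Prod.mk.injEq, mul_one]
    constructor
    · rintro ⟨w, rfl, rfl, rfl⟩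
      constructor
      · field_simp
        ring
      · ring
    · rintro ⟨hA, hB⟩
      have hx : w * ((1 - bA) / (2 * (mA - mB))) = x := by
        field_simp
        linear_combination 2 * (hA - hB)
      exact ⟨w, hx, by linear_combination mB * hx - hB, rfl⟩
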